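/- arXiv:1205.0193 — 3 statements merged into one kernel-verified Lean document; each statement's English description precedes it below -/
import Mathlib

section
/- For any tree H, W_cyc(H) = M(H): the maximum number of colors in a cyclically-interval coloring of H equals M(H) = max_{b_i, b_j ∈ V(H)} |TP(b_i,b_j)|. -/
open SimpleGraph

/-- `Q` is a `t`-cyclic interval. -/
def IsCyclicInterval (t : ℕ) (Q : Set ℕ) : Prop :=
  ∃ i₁ ∈ Set.Icc 1 t, ∃ i₂ ∈ Set.Icc 1 t,
    Q = Set.Icc (min i₁ i₂) (max i₁ i₂) ∨
    Q = Set.Icc 1 t \ (Set.Icc (min i₁ i₂) (max i₁ i₂) \ {i₁, i₂})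

/-- A proper edge `t`-coloring: colors in `[1,t]`, adjacent edges differ, all colors used. -/
def IsProperEdgeColoring {V : Type*} (G : SimpleGraph V) (t : ℕ) (φ : Sym2 V → ℕ) : Prop :=
  (∀ e ∈ G.edgeSet, φ e ∈ Set.Icc 1 t) ∧
  (∀ e₁ ∈ G.edgeSet, ∀ e₂ ∈ G.edgeSet, e₁ ≠ e₂ → (∃ x, x ∈ e₁ ∧ x ∈ e₂) → φ e₁ ≠ φ e₂) ∧
  (∀ c ∈ Set.Icc 1 t, ∃ e ∈ G.edgeSet, φ e = c)

/-- A cyclically-interval `t`-coloring. -/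
def IsCyclicIntervalColoring {V : Type*} (G : SimpleGraph V) (t : ℕ) (φ : Sym2 V → ℕ) : Prop :=
  IsProperEdgeColoring G t φ ∧
  ∀ x : V, (G.incidenceSet x).Nonempty → IsCyclicInterval t (φ '' G.incidenceSet x)

/-- An interval `t`-coloring. -/
def IsIntervalColoring {V : Type*} (G : SimpleGraph V) (t : ℕ) (φ : Sym2 V → ℕ) : Prop :=
  IsProperEdgeColoring G t φ ∧
  ∀ x : V, (G.incidenceSet x).Nonempty → ∃ a b, φ '' G.incidenceSet x = Set.Icc a b

/-- `TP(u,v)` along a path `p`. -/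
def pathTP {V : Type*} (G : SimpleGraph V) {u v : V} (p : G.Walk u v) : Set (Sym2 V) :=
  if p.length ≤ 1 then {e | e ∈ p.edges}
  else ⋃ x ∈ {w | w ∈ p.support ∧ w ≠ u ∧ w ≠ v}, G.incidenceSet x

/-- `M(H)`: maximum of `|TP(b_i,b_j)|` over pairs of vertices. -/
noncomputable def treeM {V : Type*} (G : SimpleGraph V) : ℕ :=
  sSup {n | ∃ (u v : V) (p : G.Walk u v), p.IsPath ∧ (pathTP G p).ncard = n}

noncomputable def Wcyc {V : Type*} (G : SimpleGraph V) : ℕ :=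
  sSup {t | ∃ φ, IsCyclicIntervalColoring G t φ}

noncomputable def wcyc {V : Type*} (G : SimpleGraph V) : ℕ :=
  sInf {t | ∃ φ, IsCyclicIntervalColoring G t φ}

noncomputable def Wint {V : Type*} (G : SimpleGraph V) : ℕ :=
  sSup {t | ∃ φ, IsIntervalColoring G t φ}

noncomputable def wint {V : Type*} (G : SimpleGraph V) : ℕ :=
  sInf {t | ∃ φ, IsIntervalColoring G t φ}

/-- Chromatic index: least `n` admitting a proper edge coloring with colors in `[1,n]`. -/
noncomputable def chromIndex {V : Type*} (G : SimpleGraph V) : ℕ :=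
  sInf {n | ∃ φ : Sym2 V → ℕ, (∀ e ∈ G.edgeSet, φ e ∈ Set.Icc 1 n) ∧
    (∀ e₁ ∈ G.edgeSet, ∀ e₂ ∈ G.edgeSet, e₁ ≠ e₂ → (∃ x, x ∈ e₁ ∧ x ∈ e₂) → φ e₁ ≠ φ e₂)}

section helpers
variable {V : Type*} {H : SimpleGraph V}

theorem hp_potential (hH : H.IsTree) (ω : V → V → ℤ) (hω : ∀ x y, ω y x = - ω x y) :
    ∃ c : V → ℤ, ∀ x y, H.Adj x y → c y = c x + ω x y := by
  classical
  obtain ⟨r⟩ := hH.connected.nonempty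
  choose P hP hU using fun v => hH.existsUnique_path r v
  let S : ∀ v, H.Walk r v → ℤ := fun v p => (p.darts.map (fun d => ω d.fst d.snd)).sum
  have hS : ∀ v w (p : H.Walk r v) (h : H.Adj v w), S w (p.concat h) = S v p + ω v w := by
    intro v w p h
    simp [S, Walk.darts_concat]
  refine ⟨fun v => S v (P v), fun x y h => ?_⟩
  by_cases hy : y ∈ (P x).support
  · have h1 := Walk.endpoint_notMem_support_takeUntil (hP x) hy h.ne
    have h2 := hU y _ ((hP x).takeUntil hy)
    have h3 := hU x _ (((hP x).takeUntil hy).concat h1 h.symm)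
    have h4 := hS _ _ ((P x).takeUntil y hy) h.symm
    rw [h3, h2] at h4
    have := hω x y
    simp only
    omega
  · have h3 := hU y _ ((hP x).concat hy h)
    have h4 := hS _ _ (P x) h
    rw [h3] at h4
    exact h4

theorem hp_glue (hH : H.IsTree) (l : V → Sym2 V → ℤ) :
    ∃ (c : V → ℤ) (f : Sym2 V → ℤ), ∀ x, ∀ e ∈ H.incidenceSet x, f e = l x e + c x := by
  classical
  obtain ⟨c, hc⟩ := hp_potential hH (fun x y => l x s(x, y) - l y s(x, y)) (by
    intro x y; simp only [Sym2.eq_swap (a := y) (b := x)]; ring)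
  refine ⟨c, fun e => l e.out.1 e + c e.out.1, ?_⟩
  rintro x e ⟨he, hx⟩
  have h1 : e.out.1 ∈ e := Sym2.out_fst_mem e
  by_cases hxe : e.out.1 = x
  · simp only [hxe]
  · have : e = s(x, e.out.1) := ((Sym2.mem_and_mem_iff (Ne.symm hxe)).1 ⟨hx, h1⟩)
    have h2 := hc x e.out.1 (by rw [this] at he; exact he)
    rw [← this] at h2
    simp only
    omega

theorem hp_walk {f : Sym2 V → ℤ} (hf : ∀ x, (f '' H.incidenceSet x).OrdConnected)
    {a b : V} (p : H.Walk a b) : ∀ e ∈ H.incidenceSet a, ∀ e' ∈ H.incidenceSet b,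
    ∀ z ∈ Set.Icc (f e) (f e'), ∃ w ∈ p.support, ∃ e'' ∈ H.incidenceSet w, f e'' = z := by
  induction p with
  | nil =>
    intro e he e' he' z hz
    obtain ⟨e'', h1, h2⟩ := (hf _).out ⟨e, he, rfl⟩ ⟨e', he', rfl⟩ hz
    exact ⟨_, by simp, e'', h1, h2⟩
  | @cons a c b h p ih =>
    intro e he e' he' z hz
    have hm : s(a, c) ∈ H.incidenceSet a := ⟨h, by simp⟩
    have hm' : s(a, c) ∈ H.incidenceSet c := ⟨h, by simp⟩
    rcases le_total z (f s(a, c)) with hh | hh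
    · obtain ⟨e'', h1, h2⟩ := (hf _).out ⟨e, he, rfl⟩ ⟨_, hm, rfl⟩ ⟨hz.1, hh⟩
      exact ⟨_, by simp, e'', h1, h2⟩
    · obtain ⟨w, h1, h2⟩ := ih _ hm' _ he' z ⟨hh, hz.2⟩
      exact ⟨w, by simp [h1], h2⟩

theorem hp_min (hH : H.Connected) {e₁ e₂ : Sym2 V} (h1 : e₁ ∈ H.edgeSet) (h2 : e₂ ∈ H.edgeSet)
    (hne : e₁ ≠ e₂) : ∃ (x x' y y' : V) (p : H.Walk x y) (_ : H.Adj x' x) (_ : H.Adj y y'),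
      e₁ = s(x', x) ∧ e₂ = s(y, y') ∧ p.IsPath ∧ x' ∉ p.support ∧ y' ∉ p.support ∧ x' ≠ y' := by
  classical
  have hex : ∃ n, ∃ x ∈ e₁, ∃ y ∈ e₂, ∃ p : H.Walk x y, p.length = n := by
    obtain ⟨p⟩ := hH.preconnected e₁.out.1 e₂.out.1
    exact ⟨_, _, Sym2.out_fst_mem e₁, _, Sym2.out_fst_mem e₂, p, rfl⟩
  have hmin : ∀ x ∈ e₁, ∀ y ∈ e₂, ∀ p : H.Walk x y, Nat.find hex ≤ p.length :=
    fun x hx y hy p => Nat.find_min' hex ⟨x, hx, y, hy, p, rfl⟩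
  obtain ⟨x, hx, y, hy, p0, hp0⟩ := Nat.find_spec hex
  obtain ⟨x', rfl⟩ := hx
  obtain ⟨y', rfl⟩ := hy
  have hl := p0.length_bypass_le_length
  have hpp := p0.bypass_isPath
  generalize p0.bypass = p at hl hpp
  have hxx : H.Adj x x' := h1
  have hyy : H.Adj y y' := h2
  refine ⟨x, x', y, y', p, hxx.symm, hyy, Sym2.eq_swap, rfl, hpp, ?_, ?_, ?_⟩
  · intro hm
    have := Walk.length_dropUntil_lt_length hm hxx.ne.symm
    have := hmin x' (by simp) y (by simp) (p.dropUntil x' hm)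
    omega
  · intro hm
    have := Walk.length_takeUntil_lt_length hm hyy.ne.symm
    have := hmin x (by simp) y' (by simp) (p.takeUntil y' hm)
    omega
  · rintro rfl
    have := hmin x' (by simp) x' (by simp) Walk.nil
    simp only [Walk.length_nil] at this
    have : x = y := Walk.eq_of_length_eq_zero (p := p) (by omega)
    exact hne (by rw [this])

theorem hp_upper [Finite V] (hH : H.Connected) {f : Sym2 V → ℤ}
    (hf : ∀ x, (f '' H.incidenceSet x).OrdConnected)
    {e₁ e₂ : Sym2 V} (h1 : e₁ ∈ H.edgeSet) (h2 : e₂ ∈ H.edgeSet) :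
    ∃ (u v : V) (p : H.Walk u v), p.IsPath ∧ f e₂ - f e₁ + 1 ≤ ((pathTP H p).ncard : ℤ) := by
  classical
  by_cases hne : e₁ = e₂
  · subst hne
    induction e₁ with | _ x y =>
    have hxy : H.Adj x y := h1
    refine ⟨x, y, hxy.toWalk, by simp [hxy.ne], ?_⟩
    have : pathTP H hxy.toWalk = {s(x, y)} := by
      ext e; simp [pathTP]
    rw [this]; simp
  · obtain ⟨x, x', y, y', p, hx, hy, rfl, rfl, hp, hx', hy', hxy⟩ := hp_min hH h1 h2 hne
    have hq : (Walk.cons hx (p.concat hy)).IsPath := by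
      rw [Walk.cons_isPath_iff]
      exact ⟨hp.concat hy' hy, by simp [Walk.support_concat, hx', hxy]⟩
    refine ⟨_, _, _, hq, ?_⟩
    have hTP : pathTP H (Walk.cons hx (p.concat hy)) = ⋃ w ∈ {w | w ∈ p.support}, H.incidenceSet w := by
      rw [pathTP, if_neg (by simp)]
      suffices hset : {w | w ∈ (Walk.cons hx (p.concat hy)).support ∧ w ≠ x' ∧ w ≠ y'} =
          {w | w ∈ p.support} by rw [hset]
      ext w
      simp only [Walk.support_cons, Walk.support_concat, Set.mem_ofPred_eq, List.mem_cons, List.mem_append]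
      constructor
      · rintro ⟨h | h | h, h3, h4⟩
        · exact absurd h h3
        · exact h
        · simp at h; exact absurd h h4
      · intro h
        exact ⟨Or.inr (Or.inl h), fun h5 => hx' (h5 ▸ h), fun h5 => hy' (h5 ▸ h)⟩
    rw [hTP]
    have hsub : Set.Icc (f s(x', x)) (f s(y, y')) ⊆ f '' (⋃ w ∈ {w | w ∈ p.support}, H.incidenceSet w) := by
      intro z hz
      obtain ⟨w, hw, e, he, hez⟩ := hp_walk hf p s(x', x) ⟨h1, by simp⟩ s(y, y') ⟨h2, by simp⟩ z hz
      exact ⟨e, Set.mem_biUnion (show w ∈ {w | w ∈ p.support} from hw) he, hez⟩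
    have hA := Set.ncard_le_ncard hsub (Set.toFinite _)
    have hB := Set.ncard_image_le (f := f) (Set.toFinite (⋃ w ∈ {w | w ∈ p.support}, H.incidenceSet w))
    have hC : (Set.Icc (f s(x', x)) (f s(y, y'))).ncard = (f s(y, y') + 1 - f s(x', x)).toNat := by
      rw [← Finset.coe_Icc, Set.ncard_coe_finset, Int.card_Icc]
    omega

theorem hp_bdd [Finite V] (H : SimpleGraph V) :
    BddAbove {n | ∃ (u v : V) (p : H.Walk u v), p.IsPath ∧ (pathTP H p).ncard = n} := by
  refine ⟨(Set.univ : Set (Sym2 V)).ncard, ?_⟩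
  rintro n ⟨u, v, p, -, rfl⟩
  exact Set.ncard_le_ncard (Set.subset_univ _) (Set.toFinite _)

theorem hp_upper' [Finite V] (hH : H.Connected) {f : Sym2 V → ℤ}
    (hf : ∀ x, (f '' H.incidenceSet x).OrdConnected)
    {e₁ e₂ : Sym2 V} (h1 : e₁ ∈ H.edgeSet) (h2 : e₂ ∈ H.edgeSet) :
    f e₂ - f e₁ + 1 ≤ (treeM H : ℤ) := by
  obtain ⟨u, v, p, hp, h⟩ := hp_upper hH hf h1 h2
  have : (pathTP H p).ncard ≤ treeM H := le_csSup (hp_bdd H) ⟨u, v, p, hp, rfl⟩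
  omega

theorem hp_lift {t : ℕ} {φ : Sym2 V → ℕ} {S : Set (Sym2 V)} (h : IsCyclicInterval t (φ '' S)) :
    ∃ k : Sym2 V → ℤ, ((fun e => (φ e : ℤ) + t * k e) '' S).OrdConnected := by
  classical
  obtain ⟨i, hi, j, hj, h⟩ := h
  simp only [Set.mem_Icc] at hi hj
  have key : ∀ n, n ∈ φ '' S ↔ ∃ e ∈ S, φ e = n := fun n => Iff.rfl
  rcases h with h | h
  · refine ⟨fun _ => 0, ⟨?_⟩⟩
    rw [h] at key
    simp only [Set.mem_Icc] at key
    rintro _ ⟨e, he, rfl⟩ _ ⟨e', he', rfl⟩ z hz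
    have h1 := (key _).2 ⟨e, he, rfl⟩
    have h2 := (key _).2 ⟨e', he', rfl⟩
    simp only [mul_zero, add_zero, Set.mem_Icc] at hz
    obtain ⟨e'', h3, h4⟩ := (key z.toNat).1 (by omega)
    exact ⟨e'', h3, by simp only; omega⟩
  · rw [h] at key
    simp only [Set.mem_sdiff, Set.mem_Icc, Set.mem_insert_iff, Set.mem_singleton_iff] at key
    refine ⟨fun e => if φ e ≤ min i j then 1 else 0, ⟨?_⟩⟩
    rintro _ ⟨e, he, rfl⟩ _ ⟨e', he', rfl⟩ z hz
    have h1 := (key _).2 ⟨e, he, rfl⟩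
    have h2 := (key _).2 ⟨e', he', rfl⟩
    simp only [mul_ite, mul_one, mul_zero, Set.mem_Icc] at hz
    by_cases hzt : z ≤ t
    · obtain ⟨e'', h3, h4⟩ := (key z.toNat).1 (by split_ifs at hz <;> omega)
      refine ⟨e'', h3, ?_⟩
      simp only [mul_ite, mul_one, mul_zero]
      split_ifs at hz ⊢ <;> omega
    · obtain ⟨e'', h3, h4⟩ := (key (z - t).toNat).1 (by split_ifs at hz <;> omega)
      refine ⟨e'', h3, ?_⟩
      simp only [mul_ite, mul_one, mul_zero]
      split_ifs at hz ⊢ <;> omega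

theorem hp_shift {S : Set (Sym2 V)} {f g : Sym2 V → ℤ} {c : ℤ} (h : ∀ e ∈ S, f e = g e + c)
    (hg : (g '' S).OrdConnected) : (f '' S).OrdConnected := by
  refine ⟨?_⟩
  rintro _ ⟨e, he, rfl⟩ _ ⟨e', he', rfl⟩ z hz
  have h1 := h e he
  have h2 := h e' he'
  obtain ⟨e'', h3, h4⟩ := hg.out ⟨e, he, rfl⟩ ⟨e', he', rfl⟩ (show z - c ∈ _ from ⟨by linarith [hz.1], by linarith [hz.2]⟩)
  exact ⟨e'', h3, by have := h e'' h3; linarith⟩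

theorem hp_le [Finite V] (hH : H.IsTree) (hE : H.edgeSet.Nonempty) {t : ℕ} {φ : Sym2 V → ℕ}
    (h : IsCyclicIntervalColoring H t φ) : t ≤ treeM H := by
  classical
  obtain ⟨⟨hr, -, hs⟩, hc⟩ := h
  have hl : ∀ x, ∃ k : Sym2 V → ℤ, ((fun e => (φ e : ℤ) + t * k e) '' H.incidenceSet x).OrdConnected := by
    intro x
    by_cases hx : (H.incidenceSet x).Nonempty
    · exact hp_lift (hc x hx)
    · rw [Set.not_nonempty_iff_eq_empty] at hx
      rw [hx]
      exact ⟨0, by simp [Set.ordConnected_empty]⟩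
  choose k hk using hl
  obtain ⟨c, g, hg⟩ := hp_glue hH k
  let f : Sym2 V → ℤ := fun e => φ e + t * g e
  have hf : ∀ x, (f '' H.incidenceSet x).OrdConnected := by
    intro x
    refine hp_shift (c := t * c x) ?_ (hk x)
    intro e he
    simp only [f, hg x e he]; ring
  have hfin : H.edgeSet.Finite := Set.toFinite _
  obtain ⟨e₁, he₁, hm₁⟩ := Set.exists_min_image _ f hfin hE
  obtain ⟨e₂, he₂, hm₂⟩ := Set.exists_max_image _ f hfin hE
  have hup := hp_upper' hH.connected hf he₁ he₂
  have ht : 1 ≤ t := by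
    have := hr _ he₁
    simp only [Set.mem_Icc] at this; omega
  by_contra hcon
  push Not at hcon
  -- the color of a residue class missed
  have hz : ∃ n : ℕ, 1 ≤ n ∧ n ≤ t ∧ (t : ℤ) ∣ (f e₂ + 1) - n := by
    refine ⟨((f e₂) % t).toNat + 1, by omega, ?_, ?_⟩
    · have := Int.emod_lt_of_pos (f e₂) (show (0 : ℤ) < t by omega)
      have := Int.emod_nonneg (f e₂) (show (t : ℤ) ≠ 0 by omega)
      omega
    · have := Int.emod_nonneg (f e₂) (show (t : ℤ) ≠ 0 by omega)
      push_cast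
      rw [Int.toNat_of_nonneg this]
      have := Int.dvd_self_sub_emod (x := f e₂) (m := t)
      convert this using 1; ring
  obtain ⟨n, hn1, hn2, d, hd⟩ := hz
  obtain ⟨e, he, hen⟩ := hs n ⟨hn1, hn2⟩
  have h1 := hm₁ e he
  have h2 := hm₂ e he
  have h3 : f e = f e₂ + 1 + t * (g e - d) := by
    have : f e = φ e + t * g e := rfl
    rw [this, hen]; linarith
  have h4 : (t : ℤ) * (g e - d) < 0 := by linarith
  have h5 : -(t : ℤ) < t * (g e - d) := by
    have : (treeM H : ℤ) < t := by exact_mod_cast hcon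
    linarith
  have h6 : g e - d < 0 := by
    by_contra hh
    push Not at hh
    have := mul_nonneg (show (0 : ℤ) ≤ t by omega) hh
    linarith
  nlinarith

theorem hp_local0 {S : Set (Sym2 V)} (hS : S.Finite) :
    ∃ l : Sym2 V → ℤ, Set.InjOn l S ∧ (l '' S).OrdConnected := by
  classical
  have := hS.fintype
  let g := Fintype.equivFin S
  let l : Sym2 V → ℤ := fun e => if h : e ∈ S then ((g ⟨e, h⟩ : ℕ) : ℤ) else 0
  have hl : ∀ e (h : e ∈ S), l e = ((g ⟨e, h⟩ : ℕ) : ℤ) := fun e h => by simp [l, h]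
  refine ⟨l, ?_, ⟨?_⟩⟩
  · intro e he e' he' h
    rw [hl e he, hl e' he', Nat.cast_inj, Fin.val_inj] at h
    simpa using h
  · rintro _ ⟨e, he, rfl⟩ _ ⟨e', he', rfl⟩ z hz
    rw [hl e he, hl e' he'] at hz
    have hlt := (g ⟨e', he'⟩).2
    have hz1 := hz.1
    have hz2 := hz.2
    refine ⟨(g.symm ⟨z.toNat, by omega⟩ : S), (g.symm ⟨z.toNat, by omega⟩).2, ?_⟩
    rw [hl _ (g.symm ⟨z.toNat, by omega⟩).2]
    simp only [Subtype.coe_eta, Equiv.apply_symm_apply]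
    omega

theorem hp_local {S : Set (Sym2 V)} (hS : S.Finite) {a b : Sym2 V} (ha : a ∈ S) (hb : b ∈ S)
    (hab : a ≠ b) :
    ∃ l : Sym2 V → ℤ, Set.InjOn l S ∧ (l '' S).OrdConnected ∧ l b = l a + S.ncard - 1 := by
  classical
  have := hS.fintype
  have hcard : 2 ≤ Fintype.card S := by
    have : Nontrivial S := ⟨⟨a, ha⟩, ⟨b, hb⟩, by simpa using hab⟩
    exact Fintype.one_lt_card
  have hn : S.ncard = Fintype.card S := by
    rw [← Nat.card_coe_set_eq, Nat.card_eq_fintype_card]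
  let g0 := Fintype.equivFin S
  let z0 : Fin (Fintype.card S) := ⟨0, by omega⟩
  let zl : Fin (Fintype.card S) := ⟨Fintype.card S - 1, by omega⟩
  have hz : z0 ≠ zl := by simp [z0, zl, Fin.ext_iff]; omega
  let g1 := g0.trans (Equiv.swap (g0 ⟨a, ha⟩) z0)
  have hg1 : g1 ⟨a, ha⟩ = z0 := by simp [g1]
  have hg1' : g1 ⟨b, hb⟩ ≠ z0 := by
    rw [← hg1]; intro h; exact hab (by simpa using h.symm)
  let g := g1.trans (Equiv.swap (g1 ⟨b, hb⟩) zl)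
  have hga : g ⟨a, ha⟩ = z0 := by
    simp only [g, Equiv.trans_apply, hg1]
    exact Equiv.swap_apply_of_ne_of_ne hg1'.symm hz
  have hgb : g ⟨b, hb⟩ = zl := by simp [g]
  let l : Sym2 V → ℤ := fun e => if h : e ∈ S then ((g ⟨e, h⟩ : ℕ) : ℤ) else 0
  have hl : ∀ e (h : e ∈ S), l e = ((g ⟨e, h⟩ : ℕ) : ℤ) := fun e h => by simp [l, h]
  refine ⟨l, ?_, ⟨?_⟩, ?_⟩
  · intro e he e' he' h
    rw [hl e he, hl e' he', Nat.cast_inj, Fin.val_inj] at h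
    simpa using h
  · rintro _ ⟨e, he, rfl⟩ _ ⟨e', he', rfl⟩ z hz
    rw [hl e he, hl e' he'] at hz
    have hlt := (g ⟨e', he'⟩).2
    have hz1 := hz.1
    have hz2 := hz.2
    refine ⟨(g.symm ⟨z.toNat, by omega⟩ : S), (g.symm ⟨z.toNat, by omega⟩).2, ?_⟩
    rw [hl _ (g.symm ⟨z.toNat, by omega⟩).2]
    simp only [Subtype.coe_eta, Equiv.apply_symm_apply]
    omega
  · rw [hl a ha, hl b hb, hga, hgb, hn]
    simp only [z0, zl]
    omega

theorem hp_norm [Finite V] (hH : H.Connected) {f : Sym2 V → ℤ}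
    (hf : ∀ x, (f '' H.incidenceSet x).OrdConnected)
    (hi : ∀ x, Set.InjOn f (H.incidenceSet x))
    {e₁ e₂ : Sym2 V} (h1 : e₁ ∈ H.edgeSet) (h2 : e₂ ∈ H.edgeSet) :
    ∃ (t : ℕ) (φ : Sym2 V → ℕ), IsCyclicIntervalColoring H t φ ∧ f e₂ - f e₁ + 1 ≤ t := by
  classical
  have hfin : H.edgeSet.Finite := Set.toFinite _
  obtain ⟨a, ha, hma⟩ := Set.exists_min_image _ f hfin ⟨_, h1⟩
  obtain ⟨b, hb, hmb⟩ := Set.exists_max_image _ f hfin ⟨_, h1⟩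
  have hab := hma b hb
  have hφ : ∀ e ∈ H.edgeSet, (((f e - f a + 1).toNat : ℕ) : ℤ) = f e - f a + 1 := by
    intro e he
    have := hma e he
    omega
  have hrange : ∀ e ∈ H.edgeSet, (f e - f a + 1).toNat ∈ Set.Icc 1 (f b - f a + 1).toNat := by
    intro e he
    have := hma e he
    have := hmb e he
    simp only [Set.mem_Icc]
    omega
  refine ⟨(f b - f a + 1).toNat, fun e => (f e - f a + 1).toNat, ⟨⟨hrange, ?_, ?_⟩, ?_⟩, ?_⟩
  · rintro e he e' he' hne ⟨x, hx, hx'⟩ h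
    have hh := hφ e he
    have hh' := hφ e' he'
    simp only at h
    exact hne (hi x ⟨he, hx⟩ ⟨he', hx'⟩ (by omega))
  · intro c hc
    simp only [Set.mem_Icc] at hc
    obtain ⟨p⟩ := hH.preconnected a.out.1 b.out.1
    obtain ⟨w, -, e, he, hez⟩ := hp_walk hf p a ⟨ha, Sym2.out_fst_mem a⟩ b ⟨hb, Sym2.out_fst_mem b⟩
      (c + f a - 1) ⟨by omega, by omega⟩
    exact ⟨e, he.1, by simp only; omega⟩
  · intro x hx
    have hxf : (H.incidenceSet x).Finite := Set.toFinite _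
    obtain ⟨u, hu, hmu⟩ := Set.exists_min_image _ f hxf hx
    obtain ⟨v, hv, hmv⟩ := Set.exists_max_image _ f hxf hx
    have huv := hmu v hv
    have hu1 := hma u hu.1
    have hv1 := hma v hv.1
    refine ⟨_, hrange u hu.1, _, hrange v hv.1, Or.inl ?_⟩
    ext c
    rw [Set.mem_Icc]
    constructor
    · rintro ⟨e, he, rfl⟩
      have := hmu e he
      have := hmv e he
      simp only
      omega
    · intro hc
      obtain ⟨e, he, hez⟩ := (hf x).out ⟨u, hu, rfl⟩ ⟨v, hv, rfl⟩
        (show (c : ℤ) + f a - 1 ∈ _ from ⟨by omega, by omega⟩)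
      exact ⟨e, he, by simp only; omega⟩
  · have := hma e₁ h1
    have := hmb e₂ h2
    omega

theorem hp_lower [Finite V] (hH : H.IsTree) {u v : V} (p : H.Walk u v) (hp : p.IsPath)
    (hE : H.edgeSet.Nonempty) :
    ∃ (t : ℕ) (φ : Sym2 V → ℕ), IsCyclicIntervalColoring H t φ ∧ (pathTP H p).ncard ≤ t := by
  classical
  have hloc : ∀ x, ∃ l : Sym2 V → ℤ, Set.InjOn l (H.incidenceSet x) ∧
      (l '' H.incidenceSet x).OrdConnected ∧
      ∀ i, i + 1 < p.length → p.getVert (i + 1) = x →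
        l s(p.getVert (i + 1), p.getVert (i + 2)) =
          l s(p.getVert i, p.getVert (i + 1)) + (H.incidenceSet x).ncard - 1 := by
    intro x
    by_cases hx : ∃ i, i + 1 < p.length ∧ p.getVert (i + 1) = x
    · obtain ⟨i, hi, rfl⟩ := hx
      have e1 : H.Adj (p.getVert i) (p.getVert (i + 1)) := p.adj_getVert_succ (by omega)
      have e2 : H.Adj (p.getVert (i + 1)) (p.getVert (i + 2)) := p.adj_getVert_succ (by omega)
      obtain ⟨l, h1, h2, h3⟩ := hp_local (S := H.incidenceSet (p.getVert (i + 1))) (Set.toFinite _)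
        (a := s(p.getVert i, p.getVert (i + 1))) (b := s(p.getVert (i + 1), p.getVert (i + 2)))
        ⟨e1, by simp⟩ ⟨e2, by simp⟩ (by
          intro h
          rw [Sym2.eq_swap] at h
          have h' := Sym2.congr_right.1 h
          have := hp.getVert_injOn (show i ≤ p.length by omega) (show i + 2 ≤ p.length by omega) h'
          omega)
      refine ⟨l, h1, h2, ?_⟩
      intro j hj hji
      have := hp.getVert_injOn (show j + 1 ≤ p.length by omega) (show i + 1 ≤ p.length by omega) hji
      obtain rfl : j = i := by omega
      exact h3
    · obtain ⟨l, h1, h2⟩ := hp_local0 (S := H.incidenceSet x) (Set.toFinite _)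
      exact ⟨l, h1, h2, fun i hi hix => absurd ⟨i, hi, hix⟩ hx⟩
  choose l hl1 hl2 hl3 using hloc
  obtain ⟨c, f, hf⟩ := hp_glue hH l
  have hf1 : ∀ x, Set.InjOn f (H.incidenceSet x) := by
    intro x e he e' he' h
    rw [hf x e he, hf x e' he'] at h
    exact hl1 x he he' (by omega)
  have hf2 : ∀ x, (f '' H.incidenceSet x).OrdConnected := fun x => hp_shift (hf x) (hl2 x)
  by_cases hlen : p.length ≤ 1
  · obtain ⟨e, he⟩ := hE
    obtain ⟨t, φ, h1, h2⟩ := hp_norm hH.connected hf2 hf1 he he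
    refine ⟨t, φ, h1, ?_⟩
    have : (pathTP H p).ncard ≤ 1 := by
      rw [pathTP, if_pos hlen]
      have : {e | e ∈ p.edges} = (p.edges.toFinset : Set (Sym2 V)) := by ext; simp
      rw [this, Set.ncard_coe_finset]
      refine (List.toFinset_card_le _).trans ?_
      simpa using hlen
    omega
  · push Not at hlen
    have hadj : ∀ i, i < p.length → s(p.getVert i, p.getVert (i + 1)) ∈ H.edgeSet :=
      fun i hi => p.adj_getVert_succ hi
    have key : ∀ i, i + 1 < p.length →
        ((⋃ j ∈ Set.Iic i, H.incidenceSet (p.getVert (j + 1))).ncard : ℤ) ≤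
          f s(p.getVert (i + 1), p.getVert (i + 2)) - f s(p.getVert 0, p.getVert 1) + 1 := by
      have step : ∀ i, i + 1 < p.length → f s(p.getVert (i + 1), p.getVert (i + 2)) =
          f s(p.getVert i, p.getVert (i + 1)) + (H.incidenceSet (p.getVert (i + 1))).ncard - 1 := by
        intro i hi
        rw [hf (p.getVert (i + 1)) s(p.getVert i, p.getVert (i + 1)) ⟨hadj i (by omega), by simp⟩,
          hf (p.getVert (i + 1)) s(p.getVert (i + 1), p.getVert (i + 2)) ⟨hadj (i + 1) hi, by simp⟩,
          hl3 _ i hi rfl]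
        ring
      intro i
      induction i with
      | zero =>
        intro hi
        have hs := step 0 hi
        have : (⋃ j ∈ Set.Iic 0, H.incidenceSet (p.getVert (j + 1))) =
            H.incidenceSet (p.getVert (0 + 1)) := by
          ext e; simp
        rw [this, hs, zero_add]
        linarith
      | succ i ih =>
        intro hi
        have hs := step (i + 1) hi
        have ih := ih (by omega)
        set A := ⋃ j ∈ Set.Iic i, H.incidenceSet (p.getVert (j + 1)) with hA
        set I := H.incidenceSet (p.getVert (i + 1 + 1)) with hI
        set e := s(p.getVert (i + 1), p.getVert (i + 1 + 1)) with he
        have heI : e ∈ I := ⟨hadj (i + 1) (by omega), by simp [he]⟩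
        have heA : e ∈ A := Set.mem_biUnion (show i ∈ Set.Iic i from le_refl i)
          ⟨hadj (i + 1) (by omega), by simp [he]⟩
        have hsub : (⋃ j ∈ Set.Iic (i + 1), H.incidenceSet (p.getVert (j + 1))) ⊆ A ∪ (I \ {e}) := by
          intro e' h'
          simp only [Set.mem_iUnion, Set.mem_Iic] at h'
          obtain ⟨j, hj, h'⟩ := h'
          rcases Nat.lt_or_ge i j with hij | hij
          · obtain rfl : j = i + 1 := by omega
            by_cases hee : e' = e
            · exact Or.inl (hee ▸ heA)
            · exact Or.inr ⟨h', hee⟩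
          · exact Or.inl (Set.mem_biUnion (show j ∈ Set.Iic i from hij) h')
        have q1 := Set.ncard_le_ncard hsub (Set.toFinite _)
        have q2 := Set.ncard_union_le A (I \ {e})
        have q3 := Set.ncard_sdiff_singleton_add_one heI (Set.toFinite _)
        have q4 : f s(p.getVert (i + 1), p.getVert (i + 2)) = f e := rfl
        omega
    obtain ⟨t, φ, h1, h2⟩ := hp_norm hH.connected hf2 hf1 (hadj 0 (by omega))
      (hadj (p.length - 2 + 1) (by omega))
    refine ⟨t, φ, h1, ?_⟩
    have hk := key (p.length - 2) (by omega)
    have hsub : pathTP H p ⊆ ⋃ j ∈ Set.Iic (p.length - 2), H.incidenceSet (p.getVert (j + 1)) := by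
      rw [pathTP, if_neg (by omega)]
      intro e he
      simp only [Set.mem_iUnion] at he
      obtain ⟨x, ⟨hx, hxu, hxv⟩, he⟩ := he
      obtain ⟨n, rfl, hn⟩ := Walk.mem_support_iff_exists_getVert.1 hx
      have hn0 : n ≠ 0 := by rintro rfl; simp at hxu
      have hnl : n ≠ p.length := by rintro rfl; simp at hxv
      refine Set.mem_biUnion (show n - 1 ∈ Set.Iic (p.length - 2) from ?_) ?_
      · simp only [Set.mem_Iic]; omega
      · rwa [Nat.sub_add_cancel (by omega)]
    have hq := Set.ncard_le_ncard hsub (Set.toFinite _)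
    have q4 : f s(p.getVert (p.length - 2 + 1), p.getVert (p.length - 2 + 1 + 1)) =
      f s(p.getVert (p.length - 2 + 1), p.getVert (p.length - 2 + 2)) := rfl
    have q5 : f s(p.getVert 0, p.getVert (0 + 1)) = f s(p.getVert 0, p.getVert 1) := rfl
    omega

end helpers

/-- Theorem: for any tree `H`, `W_cyc(H) = M(H)`. -/
theorem stmt6 {V : Type*} [Fintype V] (H : SimpleGraph V) (hH : H.IsTree)
    (hE : H.edgeSet.Nonempty) : Wcyc H = treeM H := by
  obtain ⟨r⟩ := hH.connected.nonempty
  obtain ⟨u, v, p, hp, hM⟩ := Nat.sSup_mem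
    (s := {n | ∃ (u v : V) (p : H.Walk u v), p.IsPath ∧ (pathTP H p).ncard = n})
    ⟨_, r, r, Walk.nil, by simp, rfl⟩ (hp_bdd H)
  obtain ⟨t, φ, hφ, ht⟩ := hp_lower hH p hp hE
  have hb : ∀ s ∈ {t | ∃ φ, IsCyclicIntervalColoring H t φ}, s ≤ treeM H := by
    rintro s ⟨ψ, hψ⟩
    exact hp_le hH hE hψ
  apply le_antisymm
  · exact csSup_le ⟨t, φ, hφ⟩ hb
  · have h1 : t ≤ Wcyc H := le_csSup ⟨_, hb⟩ ⟨φ, hφ⟩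
    exact (hM.symm.le.trans ht).trans h1
end

section
/- For an arbitrary tree H and any positive integer t, H admits a cyclically-interval t-coloring if and only if H admits an interval t-coloring. -/
open SimpleGraph

section CycHelpers

variable {V : Type*}

theorem cyc_unique_closer {H : SimpleGraph V} (hH : H.IsTree) (r : V) {u u' v : V}
    (h : H.Adj u v) (h' : H.Adj u' v) (hd : H.dist r v = H.dist r u + 1)
    (hd' : H.dist r v = H.dist r u' + 1) : u = u' := by
  obtain ⟨p, hp⟩ := hH.connected.exists_walk_length_eq_dist r u
  obtain ⟨q, hq⟩ := hH.connected.exists_walk_length_eq_dist r u'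
  have h1 : (p.concat h).IsPath := Walk.isPath_of_length_eq_dist _ (by simp [hp, hd])
  have h2 : (q.concat h').IsPath := Walk.isPath_of_length_eq_dist _ (by simp [hq, hd'])
  have h3 := (hH.isAcyclic.subsingleton_path r v).elim ⟨_, h1⟩ ⟨_, h2⟩
  have h4 : p.concat h = q.concat h' := congrArg Subtype.val h3
  have h5 := congrArg Walk.penultimate h4
  simpa using h5

theorem cyc_exists_closer {H : SimpleGraph V} (hH : H.IsTree) (r : V) {v : V} (hv : v ≠ r) :
    ∃ u, H.Adj u v ∧ H.dist r v = H.dist r u + 1 := by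
  obtain ⟨p, hp⟩ := hH.connected.exists_walk_length_eq_dist v r
  cases p with
  | nil => exact absurd rfl hv
  | @cons _ w _ h q =>
    refine ⟨w, h.symm, ?_⟩
    have h1 := dist_le q
    have h2 := hH.dist_eq_dist_add_one_of_adj r h
    rw [Walk.length_cons, dist_comm] at hp
    rw [dist_comm] at h1
    omega

theorem cyc_rooted {C : Type*} [Inhabited C] {H : SimpleGraph V} (hH : H.IsTree) (r : V)
    (A : V → (V → C) → Prop) (h0 : ∃ g, A r g)
    (hs : ∀ u v g, H.Adj u v → H.dist r v = H.dist r u + 1 → A u g → ∃ h, A v h ∧ h u = g v) :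
    ∃ (G : V → V → C) (φ : Sym2 V → C), (∀ u, A u (G u)) ∧
      (∀ u v, H.Adj u v → G u v = φ s(u, v)) := by
  classical
  choose! par hpar using fun v (hv : v ≠ r) => cyc_exists_closer hH r hv
  have wf : WellFounded (fun a b : V => H.dist r a < H.dist r b) :=
    InvImage.wf (H.dist r) Nat.lt_wfRel.wf
  obtain ⟨g0, hg0⟩ := h0
  let F0 : (v : V) → ((w : V) → H.dist r w < H.dist r v → {g // A w g}) → {g // A v g} :=
    fun v ih => if h : v = r then ⟨g0, h ▸ hg0⟩ else
      ⟨Classical.choose (hs (par v) v (ih (par v) (by have := (hpar v h).2; omega)).1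
        (hpar v h).1 (hpar v h).2 (ih (par v) _).2),
       (Classical.choose_spec (hs (par v) v (ih (par v) (by have := (hpar v h).2; omega)).1
        (hpar v h).1 (hpar v h).2 (ih (par v) _).2)).1⟩
  let F : (v : V) → {g // A v g} := wf.fix F0
  have hF : ∀ v, v ≠ r → (F v).1 (par v) = (F (par v)).1 v := by
    intro v hv
    have h1 : F v = F0 v (fun w _ => F w) := wf.fix_eq F0 v
    rw [h1]
    simp only [F0, dif_neg hv]
    exact (Classical.choose_spec (hs (par v) v (F (par v)).1
        (hpar v hv).1 (hpar v hv).2 (F (par v)).2)).2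
  have key : ∀ u v, H.Adj u v → H.dist r v = H.dist r u + 1 → (F u).1 v = (F v).1 u := by
    intro u v ha hd
    have hv : v ≠ r := by rintro rfl; simp at hd
    have : par v = u := cyc_unique_closer hH r (hpar v hv).1 ha (hpar v hv).2 hd
    have h2 := hF v hv
    rw [this] at h2
    exact h2.symm
  have sym : ∀ u v, H.Adj u v → (F u).1 v = (F v).1 u := by
    intro u v ha
    rcases hH.dist_eq_dist_add_one_of_adj r ha with h | h
    · exact (key v u ha.symm h).symm
    · exact key u v ha h
  refine ⟨fun u => (F u).1, Sym2.lift ⟨fun u v => if H.Adj u v then (F u).1 v else default, ?_⟩,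
    fun u => (F u).2, ?_⟩
  · intro u v
    by_cases h : H.Adj u v
    · simp [h, h.symm, sym u v h]
    · have h' : ¬ H.Adj v u := fun h' => h h'.symm
      simp [h, h']
  · intro u v h
    simp [h]

theorem cyc_bij1 {α : Type*} {N : Set α} {S : Set ℕ} (hN : N.Finite) (hS : S.Finite)
    (hc : N.ncard = S.ncard) {p : α} (hp : p ∈ N) {c : ℕ} (hcS : c ∈ S) :
    ∃ g : α → ℕ, Set.BijOn g N S ∧ g p = c := by
  classical
  obtain ⟨f, hf⟩ := (Set.Finite.exists_bijOn_of_encard_eq hN (t := S) (by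
    rw [← hN.cast_ncard_eq, ← hS.cast_ncard_eq, hc]) : ∃ f : α → ℕ, Set.BijOn f N S)
  have hfp := hf.mapsTo hp
  refine ⟨fun x => Equiv.swap (f p) c (f x), ?_, by simp⟩
  exact (Equiv.swap_bijOn_self (by simp [hfp, hcS])).comp hf

theorem cyc_bij2 {α : Type*} {N : Set α} {S : Set ℕ} (hN : N.Finite) (hS : S.Finite)
    (hc : N.ncard = S.ncard) {p : α} (hp : p ∈ N) {c : ℕ} (hcS : c ∈ S)
    {q : α} (hq : q ∈ N) {c' : ℕ} (hcS' : c' ∈ S) (hpq : q ≠ p) (hcc : c' ≠ c) :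
    ∃ g : α → ℕ, Set.BijOn g N S ∧ g p = c ∧ g q = c' := by
  classical
  obtain ⟨f, hf, hfp⟩ := cyc_bij1 hN hS hc hp hcS
  have hfq := hf.mapsTo hq
  refine ⟨fun x => Equiv.swap (f q) c' (f x),
    (Equiv.swap_bijOn_self (by simp [hfq, hcS'])).comp hf, ?_, by simp⟩
  show Equiv.swap (f q) c' (f p) = c
  rw [hfp]
  apply Equiv.swap_apply_of_ne_of_ne _ hcc.symm
  intro h
  exact hpq (hf.injOn hq hp (by rw [hfp, h]))

theorem cyc_lift_set {t : ℕ} {Q : Set ℕ} (h : IsCyclicInterval t Q) :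
    ∃ s : ℤ, ∀ c ∈ Q, ∃ k : ℤ, 0 ≤ k ∧ k + 1 ≤ Q.ncard ∧ (c : ℤ) ≡ s + k [ZMOD t] := by
  obtain ⟨i, hi, j, hj, h⟩ := h
  wlog hij : i ≤ j generalizing i j
  · refine this j hj i hi ?_ (by omega)
    rw [min_comm, max_comm, Set.pair_comm]; exact h
  rw [min_eq_left hij, max_eq_right hij] at h
  obtain ⟨hi1, hi2⟩ := hi
  obtain ⟨hj1, hj2⟩ := hj
  rcases h with rfl | rfl
  · refine ⟨i, fun c hc => ⟨c - i, ?_, ?_, by simp⟩⟩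
    · have := hc.1; omega
    · rw [← Finset.coe_Icc, Set.ncard_coe_finset, Nat.card_Icc]
      have := hc.1; have := hc.2; omega
  · rcases hij.eq_or_lt with rfl | hlt
    · refine ⟨1, fun c hc => ⟨c - 1, ?_, ?_, by simp⟩⟩
      · have := hc.1.1; omega
      · have : Set.Icc 1 t \ (Set.Icc i i \ {i, i}) = ((Finset.Icc 1 t : Finset ℕ) : Set ℕ) := by
          ext x; simp
        rw [this, Set.ncard_coe_finset, Nat.card_Icc]
        have := hc.1.2; omega
    · have : Set.Icc 1 t \ (Set.Icc i j \ {i, j}) =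
          ((Finset.Icc 1 i ∪ Finset.Icc j t : Finset ℕ) : Set ℕ) := by
        ext x; simp; omega
      rw [this, Set.ncard_coe_finset, Finset.card_union_of_disjoint, Nat.card_Icc, Nat.card_Icc]
      · refine ⟨j, fun c hc => ?_⟩
        simp only [Finset.coe_union, Finset.coe_Icc, Set.mem_union, Set.mem_Icc] at hc
        rcases hc with hc | hc
        · refine ⟨c + t - j, by omega, by omega, ?_⟩
          have : (j : ℤ) + (c + t - j) = c + t := by ring
          rw [this]; simp [Int.ModEq]
        · exact ⟨c - j, by omega, by omega, by simp⟩
      · rw [Finset.disjoint_left]; intro x; simp; omega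

theorem cyc_image_inc (H : SimpleGraph V) (φ : Sym2 V → ℕ) (x : V) :
    φ '' H.incidenceSet x = (fun w => φ s(x, w)) '' H.neighborSet x := by
  ext c
  constructor
  · rintro ⟨e, ⟨he, hx⟩, rfl⟩
    obtain ⟨w, rfl⟩ := Sym2.mem_iff_exists.mp hx
    exact ⟨w, he, rfl⟩
  · rintro ⟨w, hw, rfl⟩
    exact ⟨s(x, w), ⟨hw, by simp⟩, rfl⟩

theorem cyc_lift [Fintype V] {H : SimpleGraph V} (hH : H.IsTree) {t : ℕ} {φ : Sym2 V → ℕ}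
    (hφ : IsCyclicIntervalColoring H t φ) :
    ∃ ψ : Sym2 V → ℤ, (∀ u v, H.Adj u v → ((φ s(u, v) : ℕ) : ℤ) ≡ ψ s(u, v) [ZMOD t]) ∧
      ∀ u v w, H.Adj u v → H.Adj u w →
        ψ s(u, v) + 1 ≤ ψ s(u, w) + (H.neighborSet u).ncard := by
  have loc : ∀ v, ∃ (s : ℤ) (k : V → ℤ), ∀ w, H.Adj v w → 0 ≤ k w ∧
      k w + 1 ≤ (H.neighborSet v).ncard ∧ ((φ s(v, w) : ℕ) : ℤ) ≡ s + k w [ZMOD t] := by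
    intro v
    by_cases hne : (H.incidenceSet v).Nonempty
    · obtain ⟨s, hs⟩ := cyc_lift_set (hφ.2 v hne)
      rw [cyc_image_inc] at hs
      have : ∀ w, ∃ k : ℤ, H.Adj v w → 0 ≤ k ∧
          k + 1 ≤ (H.neighborSet v).ncard ∧ ((φ s(v, w) : ℕ) : ℤ) ≡ s + k [ZMOD t] := by
        intro w
        by_cases hw : H.Adj v w
        · obtain ⟨k, h1, h2, h3⟩ := hs (φ s(v, w)) ⟨w, hw, rfl⟩
          refine ⟨k, fun _ => ⟨h1, h2.trans ?_, h3⟩⟩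
          exact_mod_cast Set.ncard_image_le (Set.toFinite _)
        · exact ⟨0, fun h => absurd h hw⟩
      choose k hk using this
      exact ⟨s, k, hk⟩
    · refine ⟨0, 0, fun w hw => absurd ⟨s(v, w), ?_⟩ hne⟩
      exact ⟨hw, by simp⟩
  choose s k hk using loc
  obtain ⟨r⟩ := hH.connected.nonempty
  obtain ⟨G, ψ, hA, hG⟩ := cyc_rooted (C := ℤ) hH r
    (fun v g => ∃ m : ℤ, m ≡ s v [ZMOD t] ∧ ∀ w, g w = m + k v w)
    ⟨fun w => s r + k r w, s r, Int.ModEq.refl _, fun w => rfl⟩ (by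
      rintro u v g huv - ⟨m, hm, hg⟩
      refine ⟨fun w => (g v - k v u) + k v w, ⟨g v - k v u, ?_, fun w => rfl⟩, by ring⟩
      have h1 := (hk u v huv).2.2
      have h2 := (hk v u huv.symm).2.2
      rw [Sym2.eq_swap] at h2
      have h3 : g v ≡ s v + k v u [ZMOD t] := by
        rw [hg]
        exact ((hm.add_right _).trans h1.symm).trans h2
      have h4 := h3.sub_right (k v u)
      simpa using h4)
  refine ⟨ψ, fun u v h => ?_, fun u v w hv hw => ?_⟩
  · obtain ⟨m, hm, hg⟩ := hA u
    rw [← hG u v h, hg]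
    exact (hk u v h).2.2.trans (hm.symm.add_right _)
  · obtain ⟨m, hm, hg⟩ := hA u
    rw [← hG u v hv, ← hG u w hw, hg, hg]
    have := (hk u v hv).2.1
    have := (hk u w hw).1
    omega

def CycGreedy (H : SimpleGraph V) (t : ℕ) (r x u : V) (g : V → ℕ) : Prop :=
  ∃ a, Set.BijOn g (H.neighborSet u) (Set.Icc a (a + (H.neighborSet u).ncard - 1)) ∧
    1 ≤ a ∧ a + (H.neighborSet u).ncard - 1 ≤ t ∧
    (a + (H.neighborSet u).ncard - 1 = t ∨
      ((∀ p, H.Adj p u → H.dist r u = H.dist r p + 1 → g p = a) ∧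
       (∀ q, H.Adj q u → H.dist x u = H.dist x q + 1 → H.dist r q = H.dist r u + 1 →
          g q = a + (H.neighborSet u).ncard - 1))) ∧
    (u = r → a = 1)

theorem cyc_ncard_Icc (a d : ℕ) (hd : 1 ≤ d) : (Set.Icc a (a + d - 1)).ncard = d := by
  rw [← Finset.coe_Icc, Set.ncard_coe_finset, Nat.card_Icc]; omega

theorem cyc_greedy [Fintype V] {H : SimpleGraph V} (hH : H.IsTree) {t : ℕ} (r x : V)
    (hd1 : ∀ u, 1 ≤ (H.neighborSet u).ncard) (hdt : ∀ u, (H.neighborSet u).ncard ≤ t) :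
    ∃ (G : V → V → ℕ) (φ : Sym2 V → ℕ), (∀ u, CycGreedy H t r x u (G u)) ∧
      (∀ u v, H.Adj u v → G u v = φ s(u, v)) := by
  refine cyc_rooted hH r (CycGreedy H t r x) ?_ ?_
  · have h1 := hd1 r
    have h2 := hdt r
    have hcard := cyc_ncard_Icc 1 _ h1
    by_cases hq : ∃ q, H.Adj q r ∧ H.dist x r = H.dist x q + 1
    · obtain ⟨q, hqa, hqd⟩ := hq
      obtain ⟨g, hg, hgq⟩ := cyc_bij1 (Set.toFinite (H.neighborSet r)) (Set.toFinite _) hcard.symm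
        (p := q) hqa.symm (c := 1 + (H.neighborSet r).ncard - 1) (by simp; omega)
      refine ⟨g, 1, hg, le_rfl, by omega, Or.inr ⟨fun p _ h => by simp at h, ?_⟩, fun _ => rfl⟩
      intro q' hqa' hqd' _
      rw [cyc_unique_closer hH x hqa' hqa hqd' hqd, hgq]
    · obtain ⟨p, hp⟩ := Set.nonempty_of_ncard_ne_zero (s := H.neighborSet r) (by omega)
      obtain ⟨g, hg, -⟩ := cyc_bij1 (Set.toFinite (H.neighborSet r)) (Set.toFinite _) hcard.symm
        hp (c := 1) (by simp; omega)
      refine ⟨g, 1, hg, le_rfl, by omega, Or.inr ⟨fun p _ h => by simp at h, ?_⟩, fun _ => rfl⟩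
      intro q' hqa' hqd' _
      exact absurd ⟨q', hqa', hqd'⟩ hq
  · rintro u v f huv hduv ⟨a0, hf, ha0, hat, -, -⟩
    have hfv := hf.mapsTo (show v ∈ H.neighborSet u from huv)
    obtain ⟨c, hc⟩ : ∃ c, c = f v := ⟨_, rfl⟩
    rw [← hc] at hfv ⊢
    have hvr : v ≠ r := by rintro rfl; simp at hduv
    have hc1 : 1 ≤ c := ha0.trans hfv.1
    have hct : c ≤ t := hfv.2.trans hat
    have h1 := hd1 v
    have h2 := hdt v
    by_cases htop : t ≤ c + (H.neighborSet v).ncard - 1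
    · have hcard := cyc_ncard_Icc (t + 1 - (H.neighborSet v).ncard) _ h1
      obtain ⟨g, hg, hgu⟩ := cyc_bij1 (Set.toFinite (H.neighborSet v)) (Set.toFinite _) hcard.symm
        (p := u) huv.symm (c := c) (by simp; omega)
      exact ⟨g, ⟨_, hg, by omega, by omega, Or.inl (by omega), fun h => absurd h hvr⟩, hgu⟩
    · have hcard := cyc_ncard_Icc c _ h1
      by_cases hq : ∃ q, H.Adj q v ∧ H.dist x v = H.dist x q + 1 ∧ H.dist r q = H.dist r v + 1
      · obtain ⟨q, hqa, hqd, hqr⟩ := hq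
        have hqu : q ≠ u := by rintro rfl; omega
        have hd2 : 1 < (H.neighborSet v).ncard :=
          (Set.one_lt_ncard (Set.toFinite _)).2 ⟨q, hqa.symm, u, huv.symm, hqu⟩
        obtain ⟨g, hg, hgu, hgq⟩ := cyc_bij2 (Set.toFinite (H.neighborSet v)) (Set.toFinite _)
          hcard.symm (p := u) huv.symm (c := c) (by simp; omega) (q := q) hqa.symm
          (c' := c + (H.neighborSet v).ncard - 1) (by simp; omega) hqu (by omega)
        refine ⟨g, ⟨c, hg, hc1, by omega, Or.inr ⟨?_, ?_⟩, fun h => absurd h hvr⟩, hgu⟩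
        · intro p hp hpd
          rw [cyc_unique_closer hH r hp huv hpd hduv, hgu]
        · intro q' hqa' hqd' _
          rw [cyc_unique_closer hH x hqa' hqa hqd' hqd, hgq]
      · obtain ⟨g, hg, hgu⟩ := cyc_bij1 (Set.toFinite (H.neighborSet v)) (Set.toFinite _)
          hcard.symm (p := u) huv.symm (c := c) (by simp; omega)
        refine ⟨g, ⟨c, hg, hc1, by omega, Or.inr ⟨?_, ?_⟩, fun h => absurd h hvr⟩, hgu⟩
        · intro p hp hpd
          rw [cyc_unique_closer hH r hp huv hpd hduv, hgu]
        · intro q' hqa' hqd' hqr'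
          exact absurd ⟨q', hqa', hqd', hqr'⟩ hq

theorem cyc_main [Fintype V] {H : SimpleGraph V} (hH : H.IsTree) {t : ℕ} (ht : 1 ≤ t)
    {φ : Sym2 V → ℕ} (hφ : IsCyclicIntervalColoring H t φ) : ∃ χ, IsIntervalColoring H t χ := by
  obtain ⟨ψ, hψ1, hψ2⟩ := cyc_lift hH hφ
  obtain ⟨⟨hin, hprop, hall⟩, -⟩ := hφ
  obtain ⟨e0, he0, -⟩ := hall 1 ⟨le_rfl, ht⟩
  have hdt : ∀ u, (H.neighborSet u).ncard ≤ t := by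
    intro u
    have h1 : (Set.Icc 1 t).ncard = t := by
      simp
    rw [← h1]
    refine Set.ncard_le_ncard_of_injOn (fun w => φ s(u, w)) (fun w hw => hin _ hw) ?_
      (Set.toFinite _)
    intro v hv w hw hvw
    by_contra hne
    exact hprop _ hv _ hw (by rwa [Ne, Sym2.congr_right]) ⟨u, by simp, by simp⟩ hvw
  have hnt : Nontrivial V := by
    induction e0 with
    | h a b => exact ⟨a, b, (show H.Adj a b from he0).ne⟩
  have hd1 : ∀ u, 1 ≤ (H.neighborSet u).ncard := by
    intro u
    obtain ⟨w, hw⟩ := hH.connected.preconnected.exists_adj_of_nontrivial u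
    exact (Set.ncard_pos (Set.toFinite _)).2 ⟨w, hw⟩
  obtain ⟨emin, hemin, hmin⟩ := Set.exists_min_image H.edgeSet ψ (Set.toFinite _) ⟨e0, he0⟩
  obtain ⟨emax, hemax, hmax⟩ := Set.exists_max_image H.edgeSet ψ (Set.toFinite _) ⟨e0, he0⟩
  have hspan : ψ emin + t ≤ ψ emax + 1 := by
    choose! E hE hEc using hall
    have h1 : (Finset.Icc 1 t).card ≤ (Finset.Icc (ψ emin) (ψ emax)).card := by
      refine Finset.card_le_card_of_injOn (fun c => ψ (E c)) ?_ ?_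
      · intro c hc
        have hc' : c ∈ Set.Icc 1 t := by simpa using hc
        simpa using ⟨hmin _ (hE c hc'), hmax _ (hE c hc')⟩
      · intro c hc c' hc' h
        have hc : c ∈ Set.Icc 1 t := by simpa using hc
        have hc' : c' ∈ Set.Icc 1 t := by simpa using hc'
        have hm : ∀ c ∈ Set.Icc 1 t, (c : ℤ) ≡ ψ (E c) [ZMOD t] := by
          intro c hc
          have h1 := hE c hc
          have h2 := hEc c hc
          generalize E c = e at *
          induction e with
          | h a b => rw [← h2]; exact hψ1 a b h1
        have h3 : (c : ℤ) ≡ c' [ZMOD t] := (hm c hc).trans (by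
          have h : ψ (E c) = ψ (E c') := h
          rw [h]; exact (hm c' hc').symm)
        have h4 := (Int.natCast_modEq_iff.1 h3)
        obtain ⟨p1, p2⟩ := hc
        obtain ⟨p3, p4⟩ := hc'
        have h5 : c - 1 ≡ c' - 1 [MOD t] := by
          apply Nat.ModEq.add_right_cancel' 1
          rwa [Nat.sub_add_cancel p1, Nat.sub_add_cancel p3]
        have := Nat.ModEq.eq_of_lt_of_lt h5 (by omega) (by omega)
        omega
    have h2 := hmin _ hemax
    simp only [Nat.card_Icc, Int.card_Icc] at h1
    omega
  induction emin with | h r r' => ?_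
  induction emax with | h x x' => ?_
  have hrr : H.Adj r r' := hemin
  have hxx : H.Adj x x' := hemax
  obtain ⟨G, χ, hA, hG⟩ := cyc_greedy hH r x hd1 hdt
  choose a hbij ha1 hat hext hroot using hA
  have hbij' : ∀ u, Set.BijOn (fun w => χ s(u, w)) (H.neighborSet u)
      (Set.Icc (a u) (a u + (H.neighborSet u).ncard - 1)) := fun u =>
    (hbij u).congr (fun w hw => hG u w hw)
  have himg : ∀ u, χ '' H.incidenceSet u = Set.Icc (a u) (a u + (H.neighborSet u).ncard - 1) :=
    fun u => by rw [cyc_image_inc]; exact (hbij' u).image_eq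
  have hmem : ∀ u w, H.Adj u w → a u ≤ χ s(u, w) ∧
      χ s(u, w) ≤ a u + (H.neighborSet u).ncard - 1 := fun u w h => (hbij' u).mapsTo h
  have htop : ∃ u, a u + (H.neighborSet u).ncard - 1 = t := by
    by_contra! hno
    have claim : ∀ n w, H.dist r w = n → H.dist r w + H.dist w x = H.dist r x →
        ∀ y, H.Adj w y → ψ s(w, y) + 1 ≤ ψ s(r, r') + (a w + (H.neighborSet w).ncard - 1 : ℕ) := by
      intro n
      induction n with
      | zero =>
        intro w hw _ y hy
        obtain rfl : r = w := hH.connected.dist_eq_zero_iff.1 hw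
        have := hψ2 r y r' hy hrr
        rw [hroot r rfl]
        omega
      | succ n ih =>
        intro w hw hgeo y hy
        have hwr : w ≠ r := by rintro rfl; simp at hw
        obtain ⟨p, hpw, hpd⟩ := cyc_exists_closer hH r hwr
        have t1 := hH.connected.dist_triangle (u := r) (v := p) (w := x)
        have t2 := hH.dist_eq_dist_add_one_of_adj x hpw
        have t3 := dist_comm (G := H) (u := p) (v := x)
        have t4 := dist_comm (G := H) (u := w) (v := x)
        have h1 := ih p (by omega) (by omega) w hpw
        have h2 := hψ2 w y p hy hpw.symm
        have h3 := ((hext w).resolve_left (hno w)).1 p hpw hpd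
        have h4 := ((hext p).resolve_left (hno p)).2 w hpw.symm (by omega) hpd
        rw [hG _ _ hpw] at h4
        rw [hG _ _ hpw.symm, Sym2.eq_swap] at h3
        rw [Sym2.eq_swap (a := w) (b := p)] at h2
        have := hd1 w
        have := hd1 p
        omega
    have h1 := claim _ x rfl (by simp) x' hxx
    have h2 := hat x
    have h3 := hno x
    omega
  obtain ⟨z, hz⟩ := htop
  refine ⟨χ, ⟨?_, ?_, ?_⟩, fun u _ => ⟨_, _, himg u⟩⟩
  · intro e he
    induction e with
    | h u v => exact ⟨(ha1 u).trans (hmem u v he).1, (hmem u v he).2.trans (hat u)⟩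
  · rintro e₁ h₁ e₂ h₂ hne ⟨u, hu1, hu2⟩ heq
    obtain ⟨v, rfl⟩ := Sym2.mem_iff_exists.mp hu1
    obtain ⟨w, rfl⟩ := Sym2.mem_iff_exists.mp hu2
    exact hne (congrArg (fun y => s(u, y)) ((hbij' u).injOn h₁ h₂ heq))
  · rintro c ⟨hc1, hct⟩
    by_contra! hno
    have hside : ∀ u, ¬ (a u ≤ c ∧ c ≤ a u + (H.neighborSet u).ncard - 1) := by
      intro u hu
      obtain ⟨w, hw, hwc⟩ := (hbij' u).surjOn hu
      exact hno _ hw hwc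
    have hall : ∀ u, a u ≤ c := by
      intro u
      have hw : ∀ (u w : V) (p : H.Walk u w), a w ≤ c → a u ≤ c := by
        intro u w p
        induction p with
        | nil => exact id
        | @cons u v _ h q ih =>
          intro hc
          have h0 := ih hc
          have h1 := hside v
          have h2 := hmem u v h
          have h3 := hmem v u h.symm
          rw [Sym2.eq_swap] at h3
          omega
      obtain ⟨p⟩ := hH.connected.preconnected u r
      exact hw u r p (by rw [hroot _ rfl]; exact hc1)
    exact hside z ⟨hall z, by omega⟩

end CycHelpers

/-- For a tree `H` and positive integer `t`, `H` has a cyclically-interval `t`-coloring iff it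
has an interval `t`-coloring. -/
theorem stmt8 {V : Type*} [Fintype V] (H : SimpleGraph V) (hH : H.IsTree)
    (t : ℕ) (ht : 1 ≤ t) :
    (∃ φ, IsCyclicIntervalColoring H t φ) ↔ (∃ φ, IsIntervalColoring H t φ) := by
  constructor
  · rintro ⟨φ, hφ⟩
    exact cyc_main hH ht hφ
  · rintro ⟨φ, hφ, hint⟩
    refine ⟨φ, hφ, fun x hx => ?_⟩
    obtain ⟨a, b, hab⟩ := hint x hx
    have hsub : ∀ c ∈ φ '' H.incidenceSet x, c ∈ Set.Icc 1 t := by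
      rintro c ⟨e, he, rfl⟩
      exact hφ.1 e he.1
    have hne : (φ '' H.incidenceSet x).Nonempty := hx.image φ
    rw [hab] at hsub hne
    have hle : a ≤ b := Set.nonempty_Icc.1 hne
    refine ⟨a, hsub a ⟨le_rfl, hle⟩, b, hsub b ⟨hle, le_rfl⟩, Or.inl ?_⟩
    rw [hab, min_eq_left hle, max_eq_right hle]
end

section
/- Let α be a cyclically-interval t-coloring of a tree H and let m₀ = max over vertex pairs (b_i,b_j) of |α[TP(b_i,b_j)]|. If H has a path with at least one internal vertex, then m₀ = t. -/
open SimpleGraph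

lemma arc_lift (t : ℕ) (Q : Set ℕ) (hQ : IsCyclicInterval t Q) :
    ∃ a b : ℤ, ∀ c ∈ Set.Icc 1 t, (c ∈ Q ↔ ∃ k : ℤ, a ≤ k ∧ k ≤ b ∧ (t : ℤ) ∣ k - c) := by
  obtain ⟨i, ⟨hi1, hi2⟩, j, ⟨hj1, hj2⟩, h⟩ := hQ
  wlog hij : i ≤ j generalizing i j
  · refine this j hj1 hj2 i ?_ hi1 hi2 (by omega)
    rwa [min_comm, max_comm, Set.pair_comm]
  rw [min_eq_left hij, max_eq_right hij] at h
  rcases h with rfl | rfl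
  · refine ⟨i, j, fun c hc => ⟨fun h => ⟨c, ?_, ?_, by simp⟩, ?_⟩⟩
    · exact_mod_cast h.1
    · exact_mod_cast h.2
    · rintro ⟨k, h1, h2, h3⟩
      have h4 : k - c = 0 := by
        apply Int.eq_zero_of_abs_lt_dvd h3
        have := hc.1; have := hc.2
        rw [abs_lt]; constructor <;> omega
      simp only [Set.mem_Icc]; omega
  · refine ⟨j, i + t, fun c hc => ?_⟩
    have hc1 := hc.1
    have hc2 := hc.2
    have key : c ∈ Set.Icc 1 t \ (Set.Icc i j \ {i, j}) ↔ (c ≤ i ∨ j ≤ c) := by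
      simp only [Set.mem_sdiff, Set.mem_Icc, Set.mem_insert_iff, Set.mem_singleton_iff]
      omega
    rw [key]
    constructor
    · rintro (h | h)
      · exact ⟨c + t, by omega, by omega, by simp⟩
      · exact ⟨c, by omega, by omega, by simp⟩
    · rintro ⟨k, h1, h2, h3⟩
      by_cases hk : k ≤ t
      · have h4 : k - c = 0 := by
          apply Int.eq_zero_of_abs_lt_dvd h3
          rw [abs_lt]; constructor <;> omega
        omega
      · have h4 : k - t - c = 0 := by
          apply Int.eq_zero_of_abs_lt_dvd (m := (t : ℤ))
          · have : k - t - c = (k - c) - t := by ring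
            rw [this]; exact dvd_sub h3 dvd_rfl
          · rw [abs_lt]; constructor <;> omega
        omega

lemma tree_potential {V : Type*} (H : SimpleGraph V) (hH : H.IsTree) (t : ℤ)
    (s : V → V → ℤ) (hs : ∀ x y, s x y = - s y x) (hd : ∀ x y, H.Adj x y → t ∣ s x y) :
    ∃ h : V → ℤ, (∀ x, t ∣ h x) ∧ ∀ x y, H.Adj x y → h y = h x + s x y := by
  classical
  obtain ⟨r⟩ := hH.connected.nonempty
  choose f hf _ using (hH.existsUnique_path r ·)
  have step : ∀ x y, H.Adj x y → x ∈ (f y).support →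
      ((f y).darts.map (fun d => s d.fst d.snd)).sum =
        ((f x).darts.map (fun d => s d.fst d.snd)).sum + s x y := by
    intro x y hxy hx
    rw [hH.isAcyclic.path_concat (hf x) (hf y) hxy hx]
    simp [Walk.darts_concat]
  refine ⟨fun x => ((f x).darts.map (fun d => s d.fst d.snd)).sum, ?_, ?_⟩
  · intro x
    apply List.dvd_sum
    intro a ha
    obtain ⟨d, _, rfl⟩ := List.mem_map.1 ha
    exact hd _ _ d.adj
  · intro x y hxy
    by_cases hx : x ∈ (f y).support
    · exact step x y hxy hx
    · have hy := hH.isAcyclic.mem_support_of_ne_mem_support_of_adj_of_isPath (hf x) (hf y) hxy hx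
      have := step y x hxy.symm hy
      have := hs x y
      simp only
      omega

lemma walk_cover {V : Type*} (H : SimpleGraph V) (a b : V → ℤ)
    (hab : ∀ x y, H.Adj x y → a y ≤ b x) {u v : V} (p : H.Walk u v) (k : ℤ) :
    a u ≤ k → k ≤ b v → ∃ z ∈ p.support, a z ≤ k ∧ k ≤ b z := by
  induction p with
  | nil => intro h1 h2; exact ⟨_, by simp, h1, h2⟩
  | @cons u w v h p ih =>
    intro h1 h2
    by_cases hk : k ≤ b u
    · exact ⟨u, by simp, h1, hk⟩
    · obtain ⟨z, hz, h3⟩ := ih (by have := hab u w h; omega) h2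
      exact ⟨z, by simp [hz], h3⟩

lemma exists_cover {V : Type*} [Fintype V] (H : SimpleGraph V) (hH : H.IsTree)
    (t : ℕ) (φ : Sym2 V → ℕ) (hφ : IsCyclicIntervalColoring H t φ) :
    ∃ (u v : V) (p : H.Walk u v), p.IsPath ∧
      ∀ c ∈ Set.Icc 1 t, ∃ z ∈ p.support, c ∈ φ '' H.incidenceSet z := by
  classical
  obtain ⟨⟨hr, -, hsurj⟩, hI⟩ := hφ
  have h1 : ∀ x : V, ∃ a b : ℤ, ∀ c ∈ Set.Icc 1 t, (c ∈ φ '' H.incidenceSet x ↔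
      ∃ k : ℤ, a ≤ k ∧ k ≤ b ∧ (t : ℤ) ∣ k - c) := by
    intro x
    by_cases hx : (H.incidenceSet x).Nonempty
    · exact arc_lift t _ (hI x hx)
    · rw [Set.not_nonempty_iff_eq_empty] at hx
      refine ⟨1, 0, fun c _ => ?_⟩
      simp only [hx, Set.image_empty, Set.mem_empty_iff_false, false_iff]
      rintro ⟨k, h1, h2, -⟩
      omega
  choose a b hab using h1
  have h2 : ∀ x y : V, ∃ k : ℤ, H.Adj x y → a x ≤ k ∧ k ≤ b x ∧ (t : ℤ) ∣ k - φ s(x, y) := by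
    intro x y
    by_cases hxy : H.Adj x y
    · obtain ⟨k, hk⟩ := (hab x _ (hr s(x, y) hxy)).1
        ⟨s(x, y), by simp [incidenceSet, hxy], rfl⟩
      exact ⟨k, fun _ => hk⟩
    · exact ⟨0, fun h => absurd h hxy⟩
  choose L hL using h2
  obtain ⟨h, hd, hh⟩ := tree_potential H hH t (fun x y => L x y - L y x) (by intros; ring) (by
    intro x y hxy
    have e1 := (hL x y hxy).2.2
    have e2 := (hL y x hxy.symm).2.2
    rw [Sym2.eq_swap] at e2
    have := dvd_sub e1 e2
    simpa using this)
  have := hH.connected.nonempty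
  obtain ⟨u, hu⟩ := Finite.exists_min (fun x => a x + h x)
  obtain ⟨v, hv⟩ := Finite.exists_max (fun x => b x + h x)
  obtain ⟨p, hp, -⟩ := hH.existsUnique_path u v
  refine ⟨u, v, p, hp, fun c hc => ?_⟩
  obtain ⟨e, he, rfl⟩ := hsurj c hc
  obtain ⟨x, hx⟩ : ∃ x, x ∈ e := ⟨_, Sym2.out_fst_mem e⟩
  obtain ⟨k, k1, k2, k3⟩ := (hab x _ hc).1 ⟨e, ⟨he, hx⟩, rfl⟩
  obtain ⟨z, hz, z1, z2⟩ := walk_cover H (fun x => a x + h x) (fun x => b x + h x) (by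
    intro x y hxy
    have e1 := hL x y hxy
    have e2 := hL y x hxy.symm
    have e3 := hh x y hxy
    omega) p (k + h x) (by have := hu x; omega)
      (by have := hv x; omega)
  refine ⟨z, hz, (hab z _ hc).2 ⟨k + h x - h z, by omega, by omega, ?_⟩⟩
  have : k + h x - h z - φ e = (k - φ e) + (h x - h z) := by ring
  rw [this]
  exact dvd_add k3 (dvd_sub (hd x) (hd z))

lemma edge_mem_of_adj {V : Type*} (H : SimpleGraph V) (hH : H.IsAcyclic) {u v w : V}
    (p : H.Walk u v) (hp : p.IsPath) (hw : w ∈ p.support) (h : H.Adj u w) :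
    s(u, w) ∈ p.edges := by
  classical
  have := congrArg Subtype.val
    (hH.path_unique ⟨_, hp.takeUntil hw⟩ (Path.singleton h))
  apply p.edges_takeUntil_subset_edges hw
  simp only at this
  rw [this]
  simp

lemma exists_good {V : Type*} [Fintype V] (H : SimpleGraph V) (hH : H.IsTree)
    (t : ℕ) (φ : Sym2 V → ℕ) (hφ : IsCyclicIntervalColoring H t φ) :
    ∃ (u v : V) (p : H.Walk u v), p.IsPath ∧ Set.Icc 1 t ⊆ φ '' pathTP H p := by
  classical
  let S : Set ℕ := {n | ∃ (u v : V) (p : H.Walk u v), p.IsPath ∧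
      (∀ c ∈ Set.Icc 1 t, ∃ z ∈ p.support, c ∈ φ '' H.incidenceSet z) ∧ p.length = n}
  have hne : S.Nonempty := by
    obtain ⟨u, v, p, hp, hc⟩ := exists_cover H hH t φ hφ
    exact ⟨_, u, v, p, hp, hc, rfl⟩
  have hbd : BddAbove S := by
    refine ⟨Fintype.card V, ?_⟩
    rintro n ⟨u, v, p, hp, -, rfl⟩
    exact hp.length_lt.le
  obtain ⟨u, v, p, hp, hc, hlen⟩ := Nat.sSup_mem hne hbd
  have hmax : ∀ n ∈ S, n ≤ p.length := fun n hn => hlen ▸ le_csSup hbd hn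
  have hu : ∀ w, H.Adj u w → s(u, w) ∈ p.edges := by
    intro w hw
    by_cases hws : w ∈ p.support
    · exact edge_mem_of_adj H hH.isAcyclic p hp hws hw
    · have := hmax (p.length + 1) ⟨w, v, Walk.cons hw.symm p, hp.cons hws, fun c h => by
        obtain ⟨z, hz, h'⟩ := hc c h
        exact ⟨z, by simp [hz], h'⟩, by simp⟩
      omega
  have hv : ∀ w, H.Adj v w → s(v, w) ∈ p.edges := by
    intro w hw
    by_cases hws : w ∈ p.support
    · simpa using edge_mem_of_adj H hH.isAcyclic p.reverse hp.reverse (by simpa using hws) hw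
    · have := hmax (p.length + 1) ⟨w, u, Walk.cons hw.symm p.reverse,
        hp.reverse.cons (by simpa using hws), fun c h => by
        obtain ⟨z, hz, h'⟩ := hc c h
        exact ⟨z, by simp [hz], h'⟩, by simp⟩
      omega
  have hinc : ∀ z, z = u ∨ z = v → ∀ e ∈ H.incidenceSet z, e ∈ p.edges := by
    rintro z hz e ⟨he, hze⟩
    obtain ⟨w, rfl⟩ := Sym2.mem_iff_exists.1 hze
    rcases hz with rfl | rfl
    · exact hu w he
    · exact hv w he
  refine ⟨u, v, p, hp, fun c h => ?_⟩
  obtain ⟨z, hz, e, he, rfl⟩ := hc c h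
  refine ⟨e, ?_, rfl⟩
  unfold pathTP
  split_ifs with hl
  · apply hinc z _ e he
    by_contra hcon
    push Not at hcon
    cases p with
    | nil => simp at hz; exact hcon.1 hz
    | cons h q =>
      cases q with
      | nil => simp at hz; tauto
      | cons h' q' => simp at hl
  · simp only [Set.mem_iUnion]
    by_cases hzz : z = u ∨ z = v
    · have hep := hinc z hzz e he
      induction e with | _ x y =>
      have hx := p.fst_mem_support_of_mem_edges hep
      have hy := p.snd_mem_support_of_mem_edges hep
      have hadj : H.Adj x y := he.1
      by_cases hx' : x ≠ u ∧ x ≠ v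
      · exact ⟨x, ⟨hx, hx'⟩, hadj, by simp⟩
      by_cases hy' : y ≠ u ∧ y ≠ v
      · exact ⟨y, ⟨hy, hy'⟩, hadj, by simp⟩
      exfalso
      have huv : H.Adj u v := by
        have := hadj.ne
        have := hadj.symm
        grind
      have := congrArg (fun q => q.1.length)
        (hH.isAcyclic.path_unique ⟨p, hp⟩ (Path.singleton huv))
      simp at this
      omega
    · push Not at hzz
      exact ⟨z, ⟨hz, hzz⟩, he⟩

/-- If a tree with a path having an internal vertex carries a cyclically-interval
`t`-coloring `α`, then `m₀ = max |α[TP(b_i,b_j)]| = t`. -/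
theorem stmt17 {V : Type*} [Fintype V] (H : SimpleGraph V) (hH : H.IsTree)
    (t : ℕ) (φ : Sym2 V → ℕ) (hφ : IsCyclicIntervalColoring H t φ)
    (hpath : ∃ (u v : V) (p : H.Walk u v), p.IsPath ∧ 2 ≤ p.length) :
    sSup {n | ∃ (u v : V) (p : H.Walk u v), p.IsPath ∧ (φ '' pathTP H p).ncard = n} = t := by
  have hsub : ∀ (u v : V) (p : H.Walk u v), φ '' pathTP H p ⊆ Set.Icc 1 t := by
    rintro u v p _ ⟨e, he, rfl⟩
    apply hφ.1.1
    unfold pathTP at he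
    split_ifs at he
    · exact p.edges_subset_edgeSet he
    · simp only [Set.mem_iUnion] at he
      obtain ⟨x, _, hx⟩ := he
      exact hx.1
  have hcard : (Set.Icc 1 t).ncard = t := by
    rw [← Finset.coe_Icc, Set.ncard_coe_finset]; simp
  apply IsGreatest.csSup_eq
  constructor
  · obtain ⟨u, v, p, hp, h⟩ := exists_good H hH t φ hφ
    exact ⟨u, v, p, hp, by rw [(hsub u v p).antisymm h, hcard]⟩
  · rintro n ⟨u, v, p, hp, rfl⟩
    calc _ ≤ (Set.Icc 1 t).ncard := Set.ncard_le_ncard (hsub u v p) (Set.finite_Icc _ _)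
      _ = t := hcard
end
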